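/- Let k ≥ 0, d ≥ 1 be integers, s = (k+1)/d, and a > 0. Consider data y ∈ ℝ^n with independent coordinates y_i ~ N(θ_{0,i}, σ²), where n = N^d, N > k+1, and assume the canonical scaling 0 < ‖D_{n,d}^{(k+1)} θ₀‖₁ ≤ a n^{1−s}. For every δ ∈ (0,1) there exist constants c₁, c₂ > 0 depending only on k, d, σ, a, δ and a choice of tuning parameter λ (namely λ = c₁ √(log n) if s < 1/2, λ = c₁ log n if s = 1/2, λ = c₁ (log n)^{1/(2s+1)} (n/C_n)^{(2s−1)/(2s+1)} with C_n = ‖D_{n,d}^{(k+1)} θ₀‖₁ if s > 1/2) such that the KTF estimator satisfies, with probability at least 1 − δ: (1/n)‖θ̂ − θ₀‖₂² ≤ c₂ n^{−s} √(log n) if s < 1/2; (1/n)‖θ̂ − θ₀‖₂² ≤ c₂ n^{−s} log n if s = 1/2; and (1/n)‖θ̂ − θ₀‖₂² ≤ c₂ n^{−2s/(2s+1)} (log n)^{1/(2s+1)} if s > 1/2. -/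

import Mathlib

open scoped BigOperators ENNReal NNReal
open MeasureTheory ProbabilityTheory Matrix

noncomputable section

/-- Univariate forward difference matrix `D^{(1)}_M ∈ ℝ^{(M-1)×M}`, with entries
`(D^{(1)}_M)_{i,i} = -1`, `(D^{(1)}_M)_{i,i+1} = 1` and `0` otherwise. -/
def D1 (M : ℕ) : Matrix (Fin (M - 1)) (Fin M) ℝ :=
  Matrix.of fun i j => if (j : ℕ) = (i : ℕ) then -1 else if (j : ℕ) = (i : ℕ) + 1 then 1 else 0

/-- Univariate difference operator of order `m` on `N` points:
`D^{(0)}_N = I_N` and `D^{(m+1)}_N = D^{(1)}_{N-m} D^{(m)}_N`.  In particular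
`Dop N (k+1)` is the operator `D_N^{(k+1)} ∈ ℝ^{(N-k-1) × N}`. -/
def Dop (N : ℕ) : (m : ℕ) → Matrix (Fin (N - m)) (Fin N) ℝ
  | 0 => Matrix.of fun i j => if (i : ℕ) = (j : ℕ) then 1 else 0
  | m + 1 => D1 (N - m) * Dop N m

/-- Row index type of the order-`m` KTF penalty matrix: a coordinate direction `j`,
a row index of the univariate operator, and the values of the other `d-1` lattice
coordinates. -/
abbrev KtfIdx (N d m : ℕ) :=
  Σ j : Fin d, Fin (N - m) × ({l : Fin d // l ≠ j} → Fin N)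

/-- Order-`m` KTF penalty matrix on the lattice `{1,…,N}^d`: the vertical block
concatenation over coordinate directions `j` of `I_N ⊗ ⋯ ⊗ D^{(m)}_N ⊗ ⋯ ⊗ I_N`
(`D^{(m)}_N` in the `j`-th factor). -/
def ktfMat (N d m : ℕ) : Matrix (KtfIdx N d m) (Fin d → Fin N) ℝ :=
  Matrix.of fun p x =>
    Dop N m p.2.1 (x p.1) *
      ∏ l : {l : Fin d // l ≠ p.1}, (if p.2.2 l = x l.1 then (1:ℝ) else 0)

/-- Product Gaussian measure with coordinatewise means `θ0` and variance `σ^2`. -/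
def gaussSeq {ι : Type*} [Fintype ι] (θ0 : ι → ℝ) (σ : ℝ) : Measure (ι → ℝ) :=
  Measure.pi fun i => gaussianReal (θ0 i) (Real.toNNReal (σ ^ 2))

lemma Dop_mulVec (N m : ℕ) (F : ℕ → ℝ) (z : Fin (N - m)) :
    (Dop N m).mulVec (fun x : Fin N => F x) z = (fwdDiff 1)^[m] F z := by
  induction m with
  | zero =>
    have h : (z : ℕ) < N := z.2
    simp only [Dop, Matrix.mulVec, dotProduct, Matrix.of_apply, Function.iterate_zero, id]
    rw [Finset.sum_eq_single (⟨z, h⟩ : Fin N)]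
    · simp
    · intro b _ hb
      rw [if_neg (fun e => hb (Fin.ext e.symm)), zero_mul]
    · simp
  | succ m ih =>
    have h2 : (z : ℕ) + 1 < N - m := by have := z.2; omega
    have h1 : (z : ℕ) < N - m := by omega
    rw [Function.iterate_succ_apply', Dop, ← Matrix.mulVec_mulVec, fwdDiff,
      ← ih ⟨z, h1⟩, ← ih ⟨z + 1, h2⟩]
    generalize (Dop N m).mulVec (fun x : Fin N => F x) = v
    simp only [D1, Matrix.mulVec, dotProduct, Matrix.of_apply]
    rw [Finset.sum_eq_add (⟨z, h1⟩ : Fin (N - m)) ⟨z + 1, h2⟩]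
    · simp; ring
    · simp
    · intro c _ hc
      rw [if_neg (fun e => hc.1 (Fin.ext e)), if_neg (fun e => hc.2 (Fin.ext e)), zero_mul]
    · simp
    · simp

lemma fwdDiff_iter_congr {F G : ℕ → ℝ} {m z : ℕ} (h : ∀ x, z ≤ x → x ≤ z + m → F x = G x) :
    (fwdDiff 1)^[m] F z = (fwdDiff 1)^[m] G z := by
  rw [fwdDiff_iter_eq_sum_shift, fwdDiff_iter_eq_sum_shift]
  refine Finset.sum_congr rfl fun j hj => ?_
  have := Finset.mem_range.1 hj
  rw [h] <;> (simp only [smul_eq_mul]; omega)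

/-- Truncated powers: the fundamental solutions of the iterated forward difference. -/
def truncChoose (k z x : ℕ) : ℝ := if z < x then ((x - z - 1).choose k : ℝ) else 0

lemma fwdDiff_iter_truncChoose (k z x : ℕ) :
    (fwdDiff 1)^[k + 1] (truncChoose k z) x = if x = z then 1 else 0 := by
  induction k with
  | zero =>
    simp only [zero_add, Function.iterate_one, fwdDiff, truncChoose, Nat.choose_zero_right,
      Nat.cast_one]
    split_ifs <;> first | omega | norm_num
  | succ k ih =>
    rw [Function.iterate_succ_apply, ← ih]
    suffices h : fwdDiff 1 (truncChoose (k + 1) z) = truncChoose k z by rw [h]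
    funext x
    simp only [fwdDiff, truncChoose]
    rcases lt_trichotomy z x with h | h | h
    · rw [if_pos (by omega), if_pos h, if_pos h]
      obtain ⟨t, rfl⟩ := Nat.exists_eq_add_of_lt h
      have e1 : z + t + 1 + 1 - z - 1 = t + 1 := by omega
      have e2 : z + t + 1 - z - 1 = t := by omega
      rw [e1, e2, Nat.choose_succ_succ]
      push_cast; ring
    · subst h; simp
    · rw [if_neg (by omega), if_neg (by omega), if_neg (by omega), sub_zero]

lemma exists_poly_of_fwdDiff_eq_zero {k ℓ : ℕ} {F : ℕ → ℝ}
    (hF : ∀ z, z + (k + 1) < ℓ → (fwdDiff 1)^[k + 1] F z = 0) :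
    ∃ p : Polynomial ℝ, p.degree < (k + 1 : ℕ) ∧ ∀ x < ℓ, p.eval (x : ℝ) = F x := by
  have hvan : ∀ r, ∀ z, z + (k + 1 + r) < ℓ → (fwdDiff 1)^[k + 1 + r] F z = 0 := by
    intro r
    induction r with
    | zero => intro z hz; exact hF z hz
    | succ r ih =>
      intro z hz
      rw [← add_assoc, Function.iterate_succ_apply', fwdDiff, ih _ (by omega), ih _ (by omega),
        sub_zero]
  refine ⟨∑ j ∈ Finset.range (k + 1),
    Polynomial.C ((fwdDiff 1)^[j] F 0 / (j.factorial : ℝ)) * descPochhammer ℝ j, ?_, ?_⟩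
  · rw [← Polynomial.mem_degreeLT]
    refine Submodule.sum_mem _ fun j hj => ?_
    rw [Polynomial.mem_degreeLT]
    refine Polynomial.degree_le_natDegree.trans_lt ?_
    have h1 := Polynomial.natDegree_C_mul_le ((fwdDiff 1)^[j] F 0 / (j.factorial : ℝ))
      (descPochhammer ℝ j)
    rw [descPochhammer_natDegree] at h1
    exact_mod_cast h1.trans_lt (Finset.mem_range.1 hj)
  · intro x hx
    have h := shift_eq_sum_fwdDiff_iter 1 F x 0
    simp only [smul_eq_mul, mul_one, zero_add] at h
    rw [h, Polynomial.eval_finsetSum]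
    have hterm : ∀ j, Polynomial.eval (x : ℝ)
        (Polynomial.C ((fwdDiff 1)^[j] F 0 / (j.factorial : ℝ)) * descPochhammer ℝ j)
        = x.choose j • (fwdDiff 1)^[j] F 0 := by
      intro j
      rw [Polynomial.eval_mul, Polynomial.eval_C, descPochhammer_eval_eq_descFactorial,
        Nat.descFactorial_eq_factorial_mul_choose]
      have : (j.factorial : ℝ) ≠ 0 := by positivity
      push_cast
      rw [nsmul_eq_mul]
      field_simp
    simp only [hterm]
    rcases le_total (k + 1) (x + 1) with hkx | hkx
    · refine Finset.sum_subset (Finset.range_mono hkx) fun j hj hj' => ?_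
      rw [Finset.mem_range] at hj hj'
      obtain ⟨r, rfl⟩ := Nat.exists_eq_add_of_le (not_lt.1 hj')
      rw [hvan r 0 (by omega), smul_zero]
    · refine (Finset.sum_subset (Finset.range_mono hkx) fun j hj hj' => ?_).symm
      rw [Finset.mem_range] at hj hj'
      rw [Nat.choose_eq_zero_of_lt (by omega), zero_smul]

lemma sum_range_mul_eq (f : ℕ → ℝ) (m h : ℕ) :
    ∑ x ∈ Finset.range (m * h), f x =
      ∑ j ∈ Finset.range m, ∑ t ∈ Finset.range h, f (j * h + t) := by
  induction m with
  | zero => simp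
  | succ m ih => rw [Nat.succ_mul, Finset.sum_range_add, ih, Finset.sum_range_succ]

/-- A discrete Nikolskii inequality for sequences with vanishing differences. -/
lemma sq_mul_le_of_fwdDiff_eq_zero {k ℓ : ℕ} {F : ℕ → ℝ}
    (hF : ∀ z, z + (k + 1) < ℓ → (fwdDiff 1)^[k + 1] F z = 0) {y : ℕ} (hy : y < ℓ) :
    F y ^ 2 * ℓ ≤ (2 * (k + 1) ^ 2 * ((2 * (k + 1)) ^ k) ^ 2) *
      ∑ x ∈ Finset.range ℓ, F x ^ 2 := by
  have hk1 : (1 : ℝ) ≤ (k : ℝ) + 1 := by linarith [(Nat.cast_nonneg k : (0 : ℝ) ≤ k)]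
  have hk0 : (0 : ℝ) < (k : ℝ) + 1 := by positivity
  have hM1 : (1 : ℝ) ≤ ((2 * ((k : ℝ) + 1)) ^ k) ^ 2 := by
    apply one_le_pow₀; apply one_le_pow₀; linarith
  have hS : F y ^ 2 ≤ ∑ x ∈ Finset.range ℓ, F x ^ 2 :=
    Finset.single_le_sum (f := fun x => F x ^ 2) (fun _ _ => sq_nonneg _)
      (Finset.mem_range.2 hy)
  rcases lt_or_ge ℓ (k + 1) with hℓ | hℓ
  · have hl : (ℓ : ℝ) ≤ k + 1 := by exact_mod_cast hℓ.le
    have hc : (ℓ : ℝ) ≤ 2 * ((k : ℝ) + 1) ^ 2 * ((2 * ((k : ℝ) + 1)) ^ k) ^ 2 := by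
      nlinarith [mul_le_mul (show (1 : ℝ) * (k + 1) ≤ 2 * ((k : ℝ) + 1) ^ 2 by nlinarith) hM1
        (by norm_num) (by positivity)]
    rw [mul_comm]
    exact mul_le_mul hc hS (sq_nonneg _) (by positivity)
  obtain ⟨p, hpd, hp⟩ := exists_poly_of_fwdDiff_eq_zero hF
  set h := ℓ / (k + 1) with hh
  have hh1 : 1 ≤ h := (Nat.one_le_div_iff (by omega)).2 hℓ
  have hhℓ : (k + 1) * h ≤ ℓ := Nat.mul_div_le _ _
  have hℓh : ℓ < (k + 1) * (h + 1) := by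
    rw [mul_comm]; exact (Nat.div_lt_iff_lt_mul (by omega)).1 (by omega)
  have hℓh' : (ℓ : ℝ) ≤ 2 * (k + 1) * h := by
    have : ℓ ≤ 2 * (k + 1) * h := by nlinarith
    exact_mod_cast this
  have hh0 : (0 : ℝ) < h := by exact_mod_cast hh1
  have key : ∀ t ∈ Finset.range h, F y ^ 2 ≤
      ((k + 1) * ((2 * (k + 1)) ^ k) ^ 2) * ∑ j ∈ Finset.range (k + 1), F (j * h + t) ^ 2 := by
    intro t ht
    rw [Finset.mem_range] at ht
    have hnode : ∀ j ∈ Finset.range (k + 1), j * h + t < ℓ := by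
      intro j hj
      have : j + 1 ≤ k + 1 := Finset.mem_range.1 hj
      nlinarith
    set v : ℕ → ℝ := fun j => ((j * h + t : ℕ) : ℝ) with hv
    have hinj : Set.InjOn v (Finset.range (k + 1)) := by
      intro i _ j _ hij
      have : i * h + t = j * h + t := Nat.cast_injective (R := ℝ) hij
      exact Nat.eq_of_mul_eq_mul_right hh1 (by omega)
    have hpi := Lagrange.eq_interpolate hinj (by rwa [Finset.card_range])
    have hFy : F y = ∑ j ∈ Finset.range (k + 1),
        F (j * h + t) * (Lagrange.basis (Finset.range (k + 1)) v j).eval (y : ℝ) := by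
      rw [← hp y hy, hpi, Lagrange.interpolate_apply, Polynomial.eval_finsetSum]
      refine Finset.sum_congr rfl fun j hj => ?_
      rw [Polynomial.eval_mul, Polynomial.eval_C, ← hp _ (hnode j hj)]
    have hbas : ∀ j ∈ Finset.range (k + 1),
        ((Lagrange.basis (Finset.range (k + 1)) v j).eval (y : ℝ)) ^ 2
          ≤ ((2 * ((k : ℝ) + 1)) ^ k) ^ 2 := by
      intro j hj
      rw [← sq_abs, Lagrange.basis, Polynomial.eval_prod, Finset.abs_prod]
      refine pow_le_pow_left₀ (Finset.prod_nonneg fun _ _ => abs_nonneg _) ?_ 2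
      have hcard : ((Finset.range (k + 1)).erase j).card = k := by
        rw [Finset.card_erase_of_mem hj, Finset.card_range, Nat.add_sub_cancel]
      calc _ ≤ ∏ _i ∈ (Finset.range (k + 1)).erase j, (2 * ((k : ℝ) + 1)) := by
            refine Finset.prod_le_prod (fun _ _ => abs_nonneg _) fun i hi => ?_
            rw [Finset.mem_erase] at hi
            rw [Lagrange.basisDivisor, Polynomial.eval_mul, Polynomial.eval_C,
              Polynomial.eval_sub, Polynomial.eval_X, Polynomial.eval_C, abs_mul, abs_inv,
              inv_mul_eq_div]
            have hden : (h : ℝ) ≤ |v j - v i| := by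
              have e : v j - v i = ((j : ℝ) - i) * h := by simp only [hv]; push_cast; ring
              have hji : (1 : ℝ) ≤ |(j : ℝ) - i| := by
                have := Int.one_le_abs (sub_ne_zero.2 (Nat.cast_injective.ne hi.1.symm :
                  (j : ℤ) ≠ i))
                exact_mod_cast this
              rw [e, abs_mul, abs_of_pos hh0]
              nlinarith
            have hnum : |(y : ℝ) - v i| ≤ ℓ := by
              have h1 : (v i) < ℓ := Nat.cast_lt.2 (hnode i hi.2)
              have h2 : (0 : ℝ) ≤ v i := Nat.cast_nonneg _
              have h3 : (y : ℝ) < ℓ := by exact_mod_cast hy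
              have h4 : (0 : ℝ) ≤ y := Nat.cast_nonneg _
              rw [abs_le]; constructor <;> linarith
            rw [div_le_iff₀ (hh0.trans_le hden)]
            calc _ ≤ (ℓ : ℝ) := hnum
              _ ≤ _ := hℓh'
              _ ≤ _ := by gcongr
        _ = _ := by rw [Finset.prod_const, hcard]
    rw [hFy]
    refine sq_sum_le_card_mul_sum_sq.trans ?_
    rw [Finset.card_range, mul_assoc, Nat.cast_succ]
    refine mul_le_mul_of_nonneg_left ?_ hk0.le
    rw [Finset.mul_sum]
    refine Finset.sum_le_sum fun j hj => ?_
    rw [mul_pow, mul_comm]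
    exact mul_le_mul_of_nonneg_right (hbas j hj) (sq_nonneg _)
  have hsum := Finset.sum_le_sum key
  rw [Finset.sum_const, Finset.card_range, nsmul_eq_mul, ← Finset.mul_sum, Finset.sum_comm,
    ← sum_range_mul_eq (fun x => F x ^ 2)] at hsum
  have hsub : ∑ x ∈ Finset.range ((k + 1) * h), F x ^ 2 ≤ ∑ x ∈ Finset.range ℓ, F x ^ 2 :=
    Finset.sum_le_sum_of_subset_of_nonneg (Finset.range_mono hhℓ) fun _ _ _ => sq_nonneg _
  calc F y ^ 2 * ℓ ≤ F y ^ 2 * (2 * (k + 1) * h) :=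
        mul_le_mul_of_nonneg_left hℓh' (sq_nonneg _)
    _ = 2 * (k + 1) * (h * F y ^ 2) := by ring
    _ ≤ 2 * (k + 1) * (((k + 1) * ((2 * (k + 1)) ^ k) ^ 2) *
        ∑ x ∈ Finset.range ((k + 1) * h), F x ^ 2) :=
        mul_le_mul_of_nonneg_left hsum (by positivity)
    _ ≤ 2 * (k + 1) * (((k + 1) * ((2 * (k + 1)) ^ k) ^ 2) *
        ∑ x ∈ Finset.range ℓ, F x ^ 2) := by gcongr
    _ = _ := by ring

/-- The blocks `{x | x * 2 ^ i / N = b}` are intervals of length comparable to `N / 2 ^ i`. -/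
lemma exists_block {N : ℕ} (i : ℕ) {y : ℕ} (hy : y < N) :
    ∃ u ℓ : ℕ, (∀ x, x * 2 ^ i / N = y * 2 ^ i / N ↔ u ≤ x ∧ x < u + ℓ) ∧ u + ℓ ≤ N ∧
      N ≤ ℓ * 2 ^ (i + 1) ∧ ℓ * 2 ^ i ≤ N + 2 ^ i := by
  have hN : 0 < N := by omega
  have hq : 0 < 2 ^ i := by positivity
  rw [pow_succ]
  generalize 2 ^ i = q at *
  set b := y * q / N with hb
  obtain ⟨u, hu⟩ : ∃ u : ℕ, ∀ x, u ≤ x ↔ b * N ≤ q * x :=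
    ⟨b * N ⌈/⌉ q, fun x => by rw [ceilDiv_le_iff_le_smul hq, smul_eq_mul]⟩
  obtain ⟨v, hv⟩ : ∃ v : ℕ, ∀ x, v ≤ x ↔ (b + 1) * N ≤ q * x :=
    ⟨(b + 1) * N ⌈/⌉ q, fun x => by rw [ceilDiv_le_iff_le_smul hq, smul_eq_mul]⟩
  have hmem : ∀ x, x * q / N = b ↔ u ≤ x ∧ x < v := by
    intro x
    rw [Nat.div_eq_iff hN, hu, ← not_le, hv, not_le]
    constructor
    · rintro ⟨h1, h2⟩
      have : x * q < b * N + N := by omega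
      constructor <;> nlinarith
    · rintro ⟨h1, h2⟩
      have : x * q < b * N + N := by nlinarith
      constructor
      · linarith
      · omega
  obtain ⟨hy1, hy2⟩ := (hmem y).1 rfl
  have hbq : (b + 1) * N ≤ q * N := by
    have : b < q := (Nat.div_lt_iff_lt_mul hN).2 (by nlinarith)
    exact Nat.mul_le_mul_right _ this
  have hu1 := (hu u).1 le_rfl
  have hv1 := (hv v).1 le_rfl
  have hv2 : q * (v - 1) < (b + 1) * N := by
    have := (hv (v - 1)).not.1 (by omega); omega
  have hu2 : q * u < b * N + q := by
    rcases Nat.eq_zero_or_pos u with h0 | h0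
    · subst h0; simp; omega
    · have := (hu (u - 1)).not.1 (by omega)
      obtain ⟨w, rfl⟩ : ∃ w, u = w + 1 := ⟨u - 1, by omega⟩
      simp at this; nlinarith
  obtain ⟨ℓ, rfl⟩ : ∃ ℓ, v = u + ℓ := ⟨v - u, by omega⟩
  refine ⟨u, ℓ, hmem, (hv N).2 hbq, ?_, ?_⟩
  · rcases le_total (2 * q) N with h | h
    · nlinarith
    · have : 1 ≤ ℓ := by omega
      nlinarith
  · obtain ⟨w, hw⟩ : ∃ w, u + ℓ = w + 1 := ⟨u + ℓ - 1, by omega⟩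
    rw [hw] at hv2
    simp at hv2
    have : q * (u + ℓ) = q * (w + 1) := by rw [hw]
    nlinarith

/-- Signals whose order-`m` differences vanish inside each block of level `i`. -/
def blockSpace (N m i : ℕ) : Submodule ℝ (EuclideanSpace ℝ (Fin N)) where
  carrier := {f | ∀ z : Fin (N - m), (z : ℕ) * 2 ^ i / N = (z + m) * 2 ^ i / N →
    (Dop N m).mulVec f.ofLp z = 0}
  add_mem' := by
    intro f g hf hg z hz
    rw [WithLp.ofLp_add, Matrix.mulVec_add, Pi.add_apply, hf z hz, hg z hz, add_zero]
  zero_mem' := by intro z _; simp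
  smul_mem' := by
    intro c f hf z hz
    rw [WithLp.ofLp_smul, Matrix.mulVec_smul, Pi.smul_apply, hf z hz, smul_zero]

lemma blockSpace_mono (N m : ℕ) : Monotone (blockSpace N m) := by
  refine monotone_nat_of_le_succ fun i f hf z hz => hf z ?_
  have h : ∀ x : ℕ, x * 2 ^ i / N = x * 2 ^ (i + 1) / N / 2 := by
    intro x
    rw [Nat.div_div_eq_div_mul, pow_succ, ← mul_assoc, Nat.mul_div_mul_right _ _ two_pos]
  rw [h, h, hz]

lemma blockSpace_eq_top {N k i : ℕ} (h : N ≤ 2 ^ i) : blockSpace N (k + 1) i = ⊤ := by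
  refine eq_top_iff.2 fun f _ z hz => absurd hz (ne_of_lt ?_)
  have hN : 0 < N := by have := z.2; omega
  calc (z : ℕ) * 2 ^ i / N < (z : ℕ) * 2 ^ i / N + 1 := Nat.lt_succ_self _
    _ = ((z : ℕ) * 2 ^ i + N) / N := by rw [Nat.add_div_right _ hN]
    _ ≤ _ := Nat.div_le_div_right (by nlinarith)

lemma exists_extension {N : ℕ} (f : Fin N → ℝ) : ∃ F : ℕ → ℝ, f = fun x : Fin N => F x :=
  ⟨fun x => if h : x < N then f ⟨x, h⟩ else 0, by funext x; simp⟩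

lemma sq_apply_le_of_mem_blockSpace {N k i : ℕ} {f : EuclideanSpace ℝ (Fin N)}
    (hf : f ∈ blockSpace N (k + 1) i) (y : Fin N) :
    f y ^ 2 ≤ (2 * (k + 1) ^ 2 * ((2 * (k + 1)) ^ k) ^ 2) * (2 ^ (i + 1) / N) * ‖f‖ ^ 2 := by
  obtain ⟨u, ℓ, hblock, hle, hlen, -⟩ := exists_block i y.2
  obtain ⟨F, hF⟩ := exists_extension f.ofLp
  obtain ⟨hy1, hy2⟩ := (hblock y).1 rfl
  obtain ⟨t, ht⟩ := Nat.exists_eq_add_of_le hy1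
  have hvan : ∀ z, z + (k + 1) < ℓ → (fwdDiff 1)^[k + 1] (fun x => F (u + x)) z = 0 := by
    intro z hz
    have h1 := (hblock (u + z)).2 ⟨by omega, by omega⟩
    have h2 := (hblock (u + z + (k + 1))).2 ⟨by omega, by omega⟩
    have h := hf ⟨u + z, by omega⟩ (h1.trans h2.symm)
    rw [hF, Dop_mulVec] at h
    rw [fwdDiff_iter_eq_sum_shift] at h ⊢
    simpa only [add_assoc] using h
  have hmain := sq_mul_le_of_fwdDiff_eq_zero hvan (y := t) (by omega)
  have hfy : f y = F (u + t) := by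
    rw [← ht]; exact congrFun hF y
  have hsum : ∑ x ∈ Finset.range ℓ, F (u + x) ^ 2 ≤ ‖f‖ ^ 2 := by
    have h1 := Finset.sum_Ico_eq_sum_range (fun x => F x ^ 2) u (u + ℓ)
    rw [Nat.add_sub_cancel_left] at h1
    rw [EuclideanSpace.real_norm_sq_eq, hF, Fin.sum_univ_eq_sum_range (fun x => F x ^ 2), ← h1]
    refine Finset.sum_le_sum_of_subset_of_nonneg (fun x hx => ?_) fun _ _ _ => sq_nonneg _
    rw [Finset.mem_Ico] at hx
    rw [Finset.mem_range]
    omega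
  have hN : (0 : ℝ) < N := by have := y.2; exact_mod_cast (by omega : 0 < N)
  have hlen' : (N : ℝ) ≤ ℓ * 2 ^ (i + 1) := by exact_mod_cast hlen
  have hℓ : (0 : ℝ) < ℓ := by exact_mod_cast (by omega : 0 < ℓ)
  rw [hfy]
  set A : ℝ := 2 * (k + 1) ^ 2 * ((2 * (k + 1)) ^ k) ^ 2
  have hA : 0 ≤ A := by positivity
  calc F (u + t) ^ 2 = F (u + t) ^ 2 * ℓ * (1 / ℓ) := by field_simp
    _ ≤ A * ‖f‖ ^ 2 * (2 ^ (i + 1) / N) := by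
        have h1 : 1 / (ℓ : ℝ) ≤ 2 ^ (i + 1) / N := by
          rw [div_le_div_iff₀ hℓ hN]; linarith
        exact mul_le_mul (hmain.trans (mul_le_mul_of_nonneg_left hsum hA)) h1 (by positivity)
          (by positivity)
    _ = _ := by ring

/-- Block-localized truncated powers, a right inverse of the difference operator on blocks. -/
def blockKernel (N k i : ℕ) (z : Fin (N - (k + 1))) : EuclideanSpace ℝ (Fin N) :=
  WithLp.toLp 2 fun x => if (z : ℕ) * 2 ^ i / N = (z + (k + 1)) * 2 ^ i / N ∧
    (x : ℕ) * 2 ^ i / N = z * 2 ^ i / N then truncChoose k z x else 0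

lemma Dop_blockKernel {N k i : ℕ} (z z' : Fin (N - (k + 1)))
    (hz' : (z' : ℕ) * 2 ^ i / N = (z' + (k + 1)) * 2 ^ i / N) :
    (Dop N (k + 1)).mulVec (blockKernel N k i z).ofLp z' = if z' = z then 1 else 0 := by
  by_cases hz : (z : ℕ) * 2 ^ i / N = (z + (k + 1)) * 2 ^ i / N
  · rw [blockKernel, Dop_mulVec N (k + 1) fun x : ℕ =>
      if (z : ℕ) * 2 ^ i / N = (z + (k + 1)) * 2 ^ i / N ∧
        x * 2 ^ i / N = z * 2 ^ i / N then truncChoose k z x else 0]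
    have hwin : ∀ x, (z' : ℕ) ≤ x → x ≤ z' + (k + 1) → x * 2 ^ i / N = z' * 2 ^ i / N := by
      intro x h1 h2
      refine le_antisymm ?_ ?_
      · rw [hz']; gcongr
      · gcongr
    by_cases hzz : (z' : ℕ) * 2 ^ i / N = z * 2 ^ i / N
    · rw [fwdDiff_iter_congr (G := truncChoose k z), fwdDiff_iter_truncChoose]
      · simp only [Fin.ext_iff]
      · intro x h1 h2
        rw [if_pos ⟨hz, (hwin x h1 h2).trans hzz⟩]
    · rw [fwdDiff_iter_congr (G := fun _ => 0), if_neg (fun e => hzz (by rw [e]))]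
      · rw [fwdDiff_iter_eq_sum_shift]; simp
      · intro x h1 h2
        rw [if_neg (fun e => hzz ((hwin x h1 h2).symm.trans e.2))]
  · rw [if_neg (fun e : z' = z => hz (e ▸ hz'))]
    have : (blockKernel N k i z).ofLp = 0 := by
      funext x; simp [blockKernel, hz]
    rw [this, Matrix.mulVec_zero]; rfl

lemma norm_sq_blockKernel_le {N k i : ℕ} (hi : 2 ^ i ≤ N) (z : Fin (N - (k + 1))) :
    ‖blockKernel N k i z‖ ^ 2 ≤ (2 * (N / 2 ^ i : ℝ)) ^ (2 * k + 1) := by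
  obtain ⟨u, ℓ, hblock, hle, -, hlen⟩ := exists_block i (y := z) (N := N) (by omega)
  obtain ⟨hz1, hz2⟩ := (hblock z).1 rfl
  have hℓ : (ℓ : ℝ) ≤ 2 * (N / 2 ^ i : ℝ) := by
    rw [mul_div_assoc', le_div_iff₀ (by positivity)]
    have : ℓ * 2 ^ i ≤ 2 * N := by omega
    exact_mod_cast this
  have hterm : ∀ x : Fin N, (blockKernel N k i z).ofLp x ^ 2 ≤
      if (u ≤ (x : ℕ) ∧ (x : ℕ) < u + ℓ) then ((ℓ : ℝ) ^ k) ^ 2 else 0 := by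
    intro x
    simp only [blockKernel, hblock]
    by_cases hx : u ≤ (x : ℕ) ∧ (x : ℕ) < u + ℓ
    · rw [if_pos hx]
      split_ifs
      · rw [truncChoose]
        split_ifs
        · have h1 : ((x : ℕ) - z - 1).choose k ≤ ℓ ^ k :=
            (Nat.choose_le_pow _ _).trans (Nat.pow_le_pow_left (by omega) k)
          have h2 : (((x : ℕ) - z - 1).choose k : ℝ) ≤ (ℓ : ℝ) ^ k := by exact_mod_cast h1
          gcongr
        · simp
      · simp
    · rw [if_neg hx, if_neg (fun e => hx e.2)]; simp
  calc ‖blockKernel N k i z‖ ^ 2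
      ≤ ∑ x : Fin N, if (u ≤ (x : ℕ) ∧ (x : ℕ) < u + ℓ) then ((ℓ : ℝ) ^ k) ^ 2 else 0 := by
        rw [EuclideanSpace.real_norm_sq_eq]; exact Finset.sum_le_sum fun x _ => hterm x
    _ = ℓ * ((ℓ : ℝ) ^ k) ^ 2 := by
        rw [Fin.sum_univ_eq_sum_range
          (fun x => if (u ≤ x ∧ x < u + ℓ) then ((ℓ : ℝ) ^ k) ^ 2 else 0), ← Finset.sum_filter]
        have : (Finset.range N).filter (fun x => u ≤ x ∧ x < u + ℓ) = Finset.Ico u (u + ℓ) := by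
          ext x; simp; omega
        rw [this]; simp
    _ = (ℓ : ℝ) ^ (2 * k + 1) := by ring
    _ ≤ _ := by gcongr

open Submodule in
/-- A univariate multiresolution: the block projections `P i`, and factorizations of their
increments through the difference operator. -/
lemma exists_multiresolution (k : ℕ) : ∃ C : ℝ, 0 < C ∧ ∀ N : ℕ, k + 1 < N →
    ∃ (P : ℕ → Matrix (Fin N) (Fin N) ℝ) (K : ℕ → Matrix (Fin N) (Fin (N - (k + 1))) ℝ),
      (∀ i, N ≤ 2 ^ i → P i = 1) ∧
      (∀ i, K i * Dop N (k + 1) = P (i + 1) - P i) ∧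
      (∀ i y, ∑ x, P i x y ^ 2 ≤ C * (2 ^ i / N)) ∧
      (∀ i, 2 ^ i ≤ N → ∀ z, ∑ x, K i x z ^ 2 ≤ C * (N / 2 ^ i : ℝ) ^ (2 * k + 1)) ∧
      (∀ i j, i ≠ j → ∀ z, ∑ x, K i x z * K j x z = 0) := by
  set A : ℝ := 2 * (k + 1) ^ 2 * ((2 * (k + 1)) ^ k) ^ 2 with hA
  refine ⟨2 * A + 4 * 2 ^ (2 * k + 1), by positivity, fun N hN => ?_⟩
  set p : ℕ → EuclideanSpace ℝ (Fin N) →L[ℝ] EuclideanSpace ℝ (Fin N) :=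
    fun i => (blockSpace N (k + 1) i).starProjection with hp
  set e : Fin N → EuclideanSpace ℝ (Fin N) := fun y => EuclideanSpace.single y 1 with he
  have hN0 : (0 : ℝ) < N := by exact_mod_cast (by omega : 0 < N)
  refine ⟨fun i => Matrix.of fun x y => p i (e y) x,
    fun i => Matrix.of fun x z => (p (i + 1) - p i) (blockKernel N k i z) x, ?_, ?_, ?_, ?_, ?_⟩
  · intro i hi
    ext x y
    simp only [hp, Matrix.of_apply]
    rw [starProjection_eq_self_iff.2 (by rw [blockSpace_eq_top hi]; trivial)]
    simp [he, Matrix.one_apply]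
  · intro i
    ext x y
    have hmem : e y - ∑ z, Dop N (k + 1) z y • blockKernel N k i z ∈ blockSpace N (k + 1) i := by
      intro z' hz'
      have h1 : (Dop N (k + 1)).mulVec (e y).ofLp z' = Dop N (k + 1) z' y := by
        simp [he]
      rw [WithLp.ofLp_sub, Matrix.mulVec_sub, Pi.sub_apply, h1, WithLp.ofLp_sum,
        Matrix.mulVec_sum, Finset.sum_apply]
      simp only [WithLp.ofLp_smul, Matrix.mulVec_smul, Pi.smul_apply, Dop_blockKernel _ _ hz']
      simp
    have h0 : (p (i + 1) - p i) (e y - ∑ z, Dop N (k + 1) z y • blockKernel N k i z) = 0 := by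
      rw [_root_.sub_apply,
        starProjection_eq_self_iff.2 (blockSpace_mono N (k + 1) (Nat.le_succ i) hmem),
        starProjection_eq_self_iff.2 hmem, sub_self]
    rw [map_sub, sub_eq_zero, map_sum] at h0
    simp only [Matrix.mul_apply, Matrix.of_apply, Matrix.sub_apply]
    rw [← PiLp.sub_apply, ← _root_.sub_apply, h0]
    simp [mul_comm]
  · intro i y
    have hmem : p i (e y) ∈ blockSpace N (k + 1) i := starProjection_apply_mem _ _
    have h1 := sq_apply_le_of_mem_blockSpace hmem y
    have h2 : p i (e y) y = ‖p i (e y)‖ ^ 2 := by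
      rw [← real_inner_self_eq_norm_sq, inner_starProjection_left_eq_right,
        starProjection_eq_self_iff.2 hmem, he, EuclideanSpace.inner_single_left]
      simp
    simp only [Matrix.of_apply]
    rw [← EuclideanSpace.real_norm_sq_eq]
    rw [h2] at h1
    have h3 : ‖p i (e y)‖ ^ 2 ≤ A * (2 ^ (i + 1) / N) := by
      by_contra! h
      have : 0 ≤ A * (2 ^ (i + 1) / N : ℝ) := by positivity
      nlinarith
    refine h3.trans ?_
    rw [pow_succ]
    have : (0 : ℝ) ≤ 4 * 2 ^ (2 * k + 1) * (2 ^ i / N) := by positivity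
    linarith [show A * (2 ^ i * 2 / N : ℝ) = 2 * A * (2 ^ i / N) by ring]
  · intro i hi z
    simp only [Matrix.of_apply]
    rw [← EuclideanSpace.real_norm_sq_eq]
    have h1 : ‖(p (i + 1) - p i) (blockKernel N k i z)‖ ≤ 2 * ‖blockKernel N k i z‖ := by
      rw [_root_.sub_apply, two_mul]
      exact (norm_sub_le _ _).trans
        (add_le_add (norm_starProjection_apply_le _ _) (norm_starProjection_apply_le _ _))
    calc _ ≤ (2 * ‖blockKernel N k i z‖) ^ 2 := by gcongr
      _ = 4 * ‖blockKernel N k i z‖ ^ 2 := by ring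
      _ ≤ 4 * (2 * (N / 2 ^ i : ℝ)) ^ (2 * k + 1) := by
        gcongr; exact norm_sq_blockKernel_le hi z
      _ = 4 * 2 ^ (2 * k + 1) * (N / 2 ^ i : ℝ) ^ (2 * k + 1) := by rw [mul_pow]; ring
      _ ≤ _ := by
        gcongr
        have : 0 ≤ 2 * A := by positivity
        linarith
  · have horth : ∀ i j, i < j → ∀ u v, inner ℝ ((p (i + 1) - p i) u) ((p (j + 1) - p j) v) = 0 := by
      intro i j hij u v
      have hu : (p (i + 1) - p i) u ∈ blockSpace N (k + 1) j := by
        rw [_root_.sub_apply]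
        exact sub_mem (blockSpace_mono N (k + 1) hij (starProjection_apply_mem _ _))
          (blockSpace_mono N (k + 1) hij.le (starProjection_apply_mem _ _))
      have h1 := starProjection_inner_eq_zero v _ hu
      have h2 := starProjection_inner_eq_zero v _ (blockSpace_mono N (k + 1) (Nat.le_succ j) hu)
      rw [real_inner_comm, show (p (j + 1) - p j) v = (v - p j v) - (v - p (j + 1) v) by
        rw [_root_.sub_apply]; abel, inner_sub_left]
      simp only [hp]
      rw [h1, h2, sub_zero]
    have hsum : ∀ u v : EuclideanSpace ℝ (Fin N), ∑ x, u x * v x = inner ℝ u v := by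
      intro u v
      rw [PiLp.inner_apply]
      exact Finset.sum_congr rfl fun x _ => by simp [mul_comm]
    intro i j hij z
    simp only [Matrix.of_apply]
    rw [hsum]
    rcases lt_or_gt_of_ne hij with h | h
    · exact horth i j h _ _
    · rw [real_inner_comm]; exact horth j i h _ _

lemma prod_sub_prod_eq_sum {d : ℕ} (a b : Fin d → ℝ) :
    ∏ l, b l - ∏ l, a l = ∑ j, (b j - a j) *
      ∏ l : {l : Fin d // l ≠ j}, if (l : Fin d) < j then b l else a l := by
  have h := Finset.prod_add_ordered Finset.univ a (fun l => b l - a l)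
  simp only [add_sub_cancel] at h
  rw [h, add_sub_cancel_left]
  refine Finset.sum_congr rfl fun j _ => ?_
  rw [mul_assoc]
  congr 1
  rw [← Finset.prod_subtype (Finset.univ.erase j) (by simp) fun l => if l < j then b l else a l,
    Finset.prod_ite]
  congr 1
  · refine Finset.prod_congr ?_ fun _ _ => rfl
    ext l
    simp only [Finset.mem_filter, Finset.mem_univ, true_and, Finset.mem_erase, and_true]
    exact ⟨fun h => ⟨h.ne, h⟩, fun h => h.2⟩
  · refine Finset.prod_congr ?_ fun _ _ => rfl
    ext l
    simp only [Finset.mem_filter, Finset.mem_univ, true_and, Finset.mem_erase, and_true, not_lt]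
    exact ⟨fun h => ⟨h.ne', h.le⟩, fun h => lt_of_le_of_ne h.2 (Ne.symm h.1)⟩

lemma sum_mul_ktfMat {N d m : ℕ} (g : KtfIdx N d m → ℝ) (y : Fin d → Fin N) :
    ∑ p, g p * ktfMat N d m p y =
      ∑ j, ∑ z, g ⟨j, z, fun l => y l⟩ * Dop N m z (y j) := by
  rw [Fintype.sum_sigma]
  refine Finset.sum_congr rfl fun j _ => ?_
  rw [Fintype.sum_prod_type]
  refine Finset.sum_congr rfl fun z _ => ?_
  rw [Finset.sum_eq_single fun l : {l : Fin d // l ≠ j} => y l]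
  · simp [ktfMat]
  · intro w _ hw
    obtain ⟨l, hl⟩ := Function.ne_iff.1 hw
    have : ∏ l : {l : Fin d // l ≠ j}, (if w l = y l.1 then (1 : ℝ) else 0) = 0 :=
      Finset.prod_eq_zero (Finset.mem_univ l) (if_neg hl)
    simp only [ktfMat, Matrix.of_apply]
    rw [this, mul_zero, mul_zero]
  · simp

lemma sum_sq_sum_eq_of_orthogonal {ι κ : Type*} [Fintype κ] (s : Finset ι) (u : ι → κ → ℝ)
    (h : ∀ i ∈ s, ∀ j ∈ s, i ≠ j → ∑ x, u i x * u j x = 0) :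
    ∑ x, (∑ i ∈ s, u i x) ^ 2 = ∑ i ∈ s, ∑ x, u i x ^ 2 := by
  simp only [sq, Finset.sum_mul_sum]
  rw [Finset.sum_comm]
  refine Finset.sum_congr rfl fun i hi => ?_
  rw [Finset.sum_comm, Finset.sum_eq_single i]
  · exact fun j hj hji => h i hi j hj hji.symm
  · exact fun h => absurd hi h

/-- Decomposition of the identity on the lattice into a part of small Hilbert-Schmidt norm and
a part factoring through the KTF penalty matrix with columns of controlled norm. -/
lemma exists_ktf_decomposition (k d : ℕ) : ∃ C : ℝ, 0 < C ∧ ∀ N : ℕ, k + 1 < N →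
    ∀ J I : ℕ, N ≤ 2 ^ I → (∀ i < I, 2 ^ i ≤ N) → J ≤ I →
    ∃ (Q : Matrix (Fin d → Fin N) (Fin d → Fin N) ℝ)
      (G : Matrix (Fin d → Fin N) (KtfIdx N d (k + 1)) ℝ),
      Q + G * ktfMat N d (k + 1) = 1 ∧
      ∑ x, ∑ y, Q x y ^ 2 ≤ C * (2 ^ J) ^ d ∧
      ∀ p, ∑ x, G x p ^ 2 ≤
        C * ∑ i ∈ Finset.Ico J I, (N / 2 ^ i : ℝ) ^ (2 * k + 1) * (2 ^ i / N : ℝ) ^ (d - 1) := by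
  obtain ⟨C, hC, hall⟩ := exists_multiresolution k
  refine ⟨C ^ d + C * (2 * C) ^ (d - 1), by positivity, fun N hN J I hI hlt hJI => ?_⟩
  obtain ⟨P, K, hP1, hKD, hPn, hKn, hKo⟩ := hall N hN
  have hN0 : (0 : ℝ) < N := by exact_mod_cast (by omega : 0 < N)
  set U : ℕ → (p : KtfIdx N d (k + 1)) → (Fin d → Fin N) → ℝ := fun i p x =>
    K i (x p.1) p.2.1 * ∏ l : {l : Fin d // l ≠ p.1},
      (if (l : Fin d) < p.1 then P (i + 1) (x l) (p.2.2 l) else P i (x l) (p.2.2 l)) with hU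
  have hUU : ∀ i i' p, ∑ x, U i p x * U i' p x =
      (∑ a, K i a p.2.1 * K i' a p.2.1) * ∏ l : {l : Fin d // l ≠ p.1},
        ∑ a, (if (l : Fin d) < p.1 then P (i + 1) a (p.2.2 l) else P i a (p.2.2 l)) *
          (if (l : Fin d) < p.1 then P (i' + 1) a (p.2.2 l) else P i' a (p.2.2 l)) := by
    rintro i i' ⟨j, z, w⟩
    rw [Finset.prod_univ_sum, Fintype.piFinset_univ, Finset.sum_mul_sum, ← Fintype.sum_prod_type',
      ← (Equiv.funSplitAt j (Fin N)).sum_comp]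
    refine Finset.sum_congr rfl fun x _ => ?_
    simp only [hU, Equiv.funSplitAt_apply, Finset.prod_mul_distrib]
    ring
  refine ⟨Matrix.of fun x y => ∏ l, P J (x l) (y l),
    Matrix.of fun x p => ∑ i ∈ Finset.Ico J I, U i p x, ?_, ?_, ?_⟩
  · ext x y
    have hstep : ∀ i, ∑ p, U i p x * ktfMat N d (k + 1) p y =
        ∏ l, P (i + 1) (x l) (y l) - ∏ l, P i (x l) (y l) := by
      intro i
      rw [sum_mul_ktfMat, prod_sub_prod_eq_sum]
      refine Finset.sum_congr rfl fun j _ => ?_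
      rw [← Matrix.sub_apply, ← hKD, Matrix.mul_apply, Finset.sum_mul]
      exact Finset.sum_congr rfl fun z _ => by simp only [hU]; ring
    simp only [Matrix.add_apply, Matrix.mul_apply, Matrix.of_apply, Finset.sum_mul]
    rw [Finset.sum_comm]
    simp only [hstep]
    rw [Finset.sum_Ico_sub (fun i => ∏ l, P i (x l) (y l)) hJI, add_sub_cancel, hP1 I hI]
    simp only [Matrix.one_apply, Finset.prod_ite_zero, Finset.mem_univ, true_imp_iff,
      Finset.prod_const_one, funext_iff]
  · simp only [Matrix.of_apply, ← Finset.prod_pow]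
    rw [Finset.sum_comm]
    have h1 : ∀ y : Fin d → Fin N, ∑ x : Fin d → Fin N, ∏ l, P J (x l) (y l) ^ 2 ≤
        (C * (2 ^ J / N)) ^ d := by
      intro y
      have h2 := Finset.prod_univ_sum (fun _ : Fin d => (Finset.univ : Finset (Fin N)))
        fun l a => P J a (y l) ^ 2
      rw [Fintype.piFinset_univ] at h2
      rw [← h2]
      refine (Finset.prod_le_prod (fun l _ => Finset.sum_nonneg fun _ _ => sq_nonneg _)
        fun l _ => hPn J (y l)).trans ?_
      simp
    refine (Finset.sum_le_sum fun y _ => h1 y).trans ?_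
    simp only [Finset.sum_const, Finset.card_univ, Fintype.card_fun, Fintype.card_fin,
      nsmul_eq_mul, Nat.cast_pow]
    rw [← mul_pow, show (N : ℝ) * (C * (2 ^ J / N)) = C * 2 ^ J by field_simp, mul_pow]
    gcongr
    have : 0 ≤ C * (2 * C) ^ (d - 1) := by positivity
    linarith
  · intro p
    simp only [Matrix.of_apply]
    rw [sum_sq_sum_eq_of_orthogonal _ (fun i => U i p), Finset.mul_sum]
    · refine Finset.sum_le_sum fun i hi => ?_
      simp only [sq]
      rw [hUU]
      simp only [← sq]
      have h1 := hKn i (hlt i (Finset.mem_Ico.1 hi).2) p.2.1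
      have hcard : Fintype.card {l : Fin d // l ≠ p.1} = d - 1 := by simp
      have h2 : ∏ l : {l : Fin d // l ≠ p.1},
          ∑ a, (if (l : Fin d) < p.1 then P (i + 1) a (p.2.2 l) else P i a (p.2.2 l)) ^ 2 ≤
          (2 * C * (2 ^ i / N)) ^ (d - 1) := by
        rw [← hcard, ← Finset.card_univ, ← Finset.prod_const]
        refine Finset.prod_le_prod (fun l _ => Finset.sum_nonneg fun _ _ => sq_nonneg _)
          fun l _ => ?_
        split_ifs
        · refine (hPn (i + 1) _).trans (le_of_eq ?_)
          rw [pow_succ]; ring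
        · refine (hPn i _).trans ?_
          have : 0 ≤ C * (2 ^ i / N) := by positivity
          linarith
      refine (mul_le_mul h1 h2 (Finset.prod_nonneg fun l _ =>
        Finset.sum_nonneg fun _ _ => sq_nonneg _) (by positivity)).trans ?_
      rw [mul_pow (2 * C)]
      have : 0 ≤ C ^ d * ((N / 2 ^ i : ℝ) ^ (2 * k + 1) * (2 ^ i / N : ℝ) ^ (d - 1)) := by
        positivity
      linarith
    · intro i _ j _ hij
      rw [hUU, hKo i j hij, zero_mul]

lemma hasSubgaussianMGF_gaussianReal (θ : ℝ) (v : ℝ≥0) :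
    HasSubgaussianMGF (fun t => t - θ) v (gaussianReal θ v) := by
  have hmap := gaussianReal_map_sub_const (μ := θ) (v := v) θ
  rw [sub_self] at hmap
  refine HasSubgaussianMGF.of_map (X := id) (Y := fun t => t - θ)
    (measurable_id.sub_const θ).aemeasurable ?_
  rw [hmap]
  exact ⟨fun t => integrable_exp_mul_gaussianReal t, fun t => by
    rw [mgf_id_gaussianReal]; simp⟩

lemma hasSubgaussianMGF_mono {Ω : Type*} {mΩ : MeasurableSpace Ω} {μ : Measure Ω} {X : Ω → ℝ}
    {c c' : ℝ≥0} (h : HasSubgaussianMGF X c μ) (hc : c ≤ c') : HasSubgaussianMGF X c' μ :=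
  ⟨h.integrable_exp_mul, fun t => (h.mgf_le t).trans (by gcongr)⟩

instance isProbabilityMeasure_gaussSeq {ι : Type*} [Fintype ι] (θ0 : ι → ℝ) (σ : ℝ) :
    IsProbabilityMeasure (gaussSeq θ0 σ) := by
  unfold gaussSeq; infer_instance

lemma hasSubgaussianMGF_gaussSeq {ι : Type*} [Fintype ι] (θ0 : ι → ℝ) (σ : ℝ) (g : ι → ℝ)
    {L : ℝ} (hL : ∑ x, g x ^ 2 ≤ L) :
    HasSubgaussianMGF (fun y => ∑ x, g x * (y x - θ0 x)) (σ ^ 2 * L).toNNReal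
      (gaussSeq θ0 σ) := by
  have hind : iIndepFun (fun x (y : ι → ℝ) => g x * (y x - θ0 x)) (gaussSeq θ0 σ) :=
    iIndepFun_pi (X := fun x t => g x * (t - θ0 x)) fun x => by fun_prop
  have hx : ∀ x ∈ Finset.univ, HasSubgaussianMGF (fun y : ι → ℝ => g x * (y x - θ0 x))
      (Real.toNNReal (g x ^ 2) * Real.toNNReal (σ ^ 2)) (gaussSeq θ0 σ) := by
    intro x _
    rw [Real.toNNReal_of_nonneg (sq_nonneg (g x))]
    refine HasSubgaussianMGF.const_mul ?_ (g x)
    refine HasSubgaussianMGF.of_map (X := fun t => t - θ0 x) (Y := fun y : ι → ℝ => y x)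
      (measurable_pi_apply x).aemeasurable ?_
    rw [gaussSeq, (measurePreserving_eval _ x).map_eq]
    exact hasSubgaussianMGF_gaussianReal _ _
  refine hasSubgaussianMGF_mono (HasSubgaussianMGF.sum_of_iIndepFun hind hx) ?_
  rw [← NNReal.coe_le_coe, NNReal.coe_sum]
  have h0 : 0 ≤ L := (Finset.sum_nonneg fun _ _ => sq_nonneg _).trans hL
  rw [Real.coe_toNNReal _ (by positivity)]
  simp only [NNReal.coe_mul, Real.coe_toNNReal _ (sq_nonneg _)]
  rw [← Finset.sum_mul, mul_comm]
  exact mul_le_mul_of_nonneg_left hL (sq_nonneg _)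

lemma gaussSeq_abs_tail {ι : Type*} [Fintype ι] (θ0 : ι → ℝ) {σ : ℝ} (g : ι → ℝ)
    {L t : ℝ} (hL : ∑ x, g x ^ 2 ≤ L) (ht : 0 ≤ t) :
    (gaussSeq θ0 σ).real {y | t ≤ |∑ x, g x * (y x - θ0 x)|} ≤
      2 * Real.exp (-t ^ 2 / (2 * (σ ^ 2 * L))) := by
  have h0 : 0 ≤ L := (Finset.sum_nonneg fun _ _ => sq_nonneg _).trans hL
  have h := hasSubgaussianMGF_gaussSeq θ0 σ g hL
  have h1 := h.measure_ge_le ht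
  have h2 := h.neg.measure_ge_le ht
  rw [Real.coe_toNNReal _ (by positivity)] at h1 h2
  have hsub : {y | t ≤ |∑ x, g x * (y x - θ0 x)|} ⊆ {y | t ≤ ∑ x, g x * (y x - θ0 x)} ∪
      {y | t ≤ (-fun y : ι → ℝ => ∑ x, g x * (y x - θ0 x)) y} := by
    intro y hy
    exact le_abs.1 (show t ≤ |∑ x, g x * (y x - θ0 x)| from hy)
  refine (measureReal_mono hsub).trans ((measureReal_union_le _ _).trans ?_)
  linarith

lemma integral_sq_gaussSeq {ι : Type*} [Fintype ι] (θ0 : ι → ℝ) (σ : ℝ) (g : ι → ℝ) :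
    Integrable (fun y => (∑ x, g x * (y x - θ0 x)) ^ 2) (gaussSeq θ0 σ) ∧
    ∫ y, (∑ x, g x * (y x - θ0 x)) ^ 2 ∂(gaussSeq θ0 σ) = σ ^ 2 * ∑ x, g x ^ 2 := by
  have hsub := hasSubgaussianMGF_gaussSeq θ0 σ g le_rfl
  refine ⟨(hsub.memLp 2).integrable_sq, ?_⟩
  have hmem : ∀ x, MemLp (fun t => g x * (t - θ0 x)) 2
      (gaussianReal (θ0 x) (Real.toNNReal (σ ^ 2))) := fun x =>
    ((hasSubgaussianMGF_gaussianReal _ _).memLp 2).const_mul (g x)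
  have hmean : ∫ y, ∑ x, g x * (y x - θ0 x) ∂(gaussSeq θ0 σ) = 0 := by
    rw [integral_finsetSum]
    · refine Finset.sum_eq_zero fun x _ => ?_
      rw [gaussSeq, integral_comp_eval (μ := fun x => gaussianReal (θ0 x) (Real.toNNReal (σ ^ 2)))
        (f := fun t => g x * (t - θ0 x)) (hmem x).aestronglyMeasurable,
        integral_const_mul, integral_sub, integral_id_gaussianReal]
      · simp
      · exact (memLp_id_gaussianReal 1).integrable le_rfl
      · exact integrable_const _
    · intro x _
      exact ((hmem x).comp_measurePreserving (measurePreserving_eval _ x)).integrable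
        (by norm_num)
  have hvar := variance_sum_pi hmem
  rw [← gaussSeq] at hvar
  have hfun : (∑ x, fun y : ι → ℝ => g x * (y x - θ0 x)) =
      fun y => ∑ x, g x * (y x - θ0 x) := by
    funext y; simp
  rw [hfun, variance_of_integral_eq_zero hsub.aemeasurable hmean] at hvar
  rw [hvar, Finset.mul_sum]
  refine Finset.sum_congr rfl fun x _ => ?_
  rw [variance_const_mul, variance_sub_const measurable_id'.aestronglyMeasurable]
  have := variance_id_gaussianReal (μ := θ0 x) (v := Real.toNNReal (σ ^ 2))
  rw [Real.coe_toNNReal _ (sq_nonneg σ)] at this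
  rw [show Var[fun t => t; gaussianReal (θ0 x) (Real.toNNReal (σ ^ 2))] = σ ^ 2 from this,
    mul_comm]

/-- With probability at least `1 - δ`, the `Q`-part of Gaussian noise is small in `ℓ²` and the
`G`-part is small in `ℓ^∞`. -/
lemma gaussSeq_good_event {ι κ : Type*} [Fintype ι] [Fintype κ] (θ0 : ι → ℝ) {σ δ T L t : ℝ}
    (hσ : 0 < σ) (hδ : 0 < δ) (hT : 0 < T) (ht : 0 ≤ t)
    (Q : Matrix ι ι ℝ) (G : Matrix ι κ ℝ) (hQ : ∑ x, ∑ y, Q x y ^ 2 ≤ T)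
    (hG : ∀ p, ∑ x, G x p ^ 2 ≤ L)
    (htail : Fintype.card κ * (2 * Real.exp (-t ^ 2 / (2 * (σ ^ 2 * L)))) ≤ δ / 2) :
    ENNReal.ofReal (1 - δ) ≤ gaussSeq θ0 σ {y | (∑ z, (∑ x, Q x z * (y x - θ0 x)) ^ 2 ≤
      2 * σ ^ 2 * T / δ) ∧ ∀ p, |∑ x, G x p * (y x - θ0 x)| ≤ t} := by
  set μ := gaussSeq θ0 σ
  set A := {y : ι → ℝ | 2 * σ ^ 2 * T / δ ≤ ∑ z, (∑ x, Q x z * (y x - θ0 x)) ^ 2}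
  set B := fun p => {y : ι → ℝ | t ≤ |∑ x, G x p * (y x - θ0 x)|}
  have hA : μ.real A ≤ δ / 2 := by
    have h := mul_meas_ge_le_integral_of_nonneg (μ := μ)
      (f := fun y => ∑ z, (∑ x, Q x z * (y x - θ0 x)) ^ 2)
      (Filter.Eventually.of_forall fun y => Finset.sum_nonneg fun _ _ => sq_nonneg _)
      (integrable_finsetSum _ fun z _ => (integral_sq_gaussSeq θ0 σ fun x => Q x z).1)
      (2 * σ ^ 2 * T / δ)
    rw [integral_finsetSum _ fun z _ => (integral_sq_gaussSeq θ0 σ fun x => Q x z).1] at h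
    simp only [(integral_sq_gaussSeq θ0 σ _).2] at h
    rw [← Finset.mul_sum, Finset.sum_comm] at h
    have h2 : 2 * σ ^ 2 * T / δ * μ.real A ≤ σ ^ 2 * T :=
      h.trans (mul_le_mul_of_nonneg_left hQ (sq_nonneg _))
    have h3 : 0 < 2 * σ ^ 2 * T / δ := by positivity
    rw [← mul_le_mul_iff_right₀ h3]
    refine h2.trans (le_of_eq ?_)
    field_simp
  have hB : μ.real (⋃ p, B p) ≤ δ / 2 := by
    refine (measureReal_iUnion_fintype_le _).trans ?_
    refine (Finset.sum_le_sum fun p _ => gaussSeq_abs_tail θ0 (fun x => G x p) (hG p) ht).trans ?_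
    simpa using htail
  have hAB : μ.real (A ∪ ⋃ p, B p) ≤ δ := by
    refine (measureReal_union_le _ _).trans ?_
    linarith
  have hmeas : MeasurableSet (A ∪ ⋃ p, B p) := by
    refine (measurableSet_le measurable_const ?_).union
      (MeasurableSet.iUnion fun p => measurableSet_le measurable_const ?_) <;> fun_prop
  have hcompl : 1 - δ ≤ μ.real (A ∪ ⋃ p, B p)ᶜ := by
    rw [probReal_compl_eq_one_sub hmeas]; linarith
  refine (ENNReal.ofReal_le_ofReal hcompl).trans ?_
  rw [ofReal_measureReal]
  refine measure_mono fun y hy => ?_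
  simp only [Set.mem_compl_iff, Set.mem_union, Set.mem_iUnion, not_or, not_exists] at hy
  exact ⟨(not_le.1 hy.1).le, fun p => (not_le.1 (hy.2 p)).le⟩

/-- The basic inequality for the penalized least squares estimator. -/
lemma sum_sq_sub_le_of_decomposition {ι κ : Type*} [Fintype ι] [Fintype κ] [DecidableEq ι]
    {D : Matrix κ ι ℝ} {Q : Matrix ι ι ℝ} {G : Matrix ι κ ℝ} (hQG : Q + G * D = 1)
    {θ θ0 y : ι → ℝ} {lam B : ℝ}
    (hmin : (1 / 2) * ∑ x, (y x - θ x) ^ 2 + lam * ∑ p, |(D *ᵥ θ) p| ≤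
      (1 / 2) * ∑ x, (y x - θ0 x) ^ 2 + lam * ∑ p, |(D *ᵥ θ0) p|)
    (hB : ∑ z, (∑ x, Q x z * (y x - θ0 x)) ^ 2 ≤ B)
    (hlam : ∀ p, |∑ x, G x p * (y x - θ0 x)| ≤ lam) :
    ∑ x, (θ x - θ0 x) ^ 2 ≤ 4 * B + 8 * (lam * ∑ p, |(D *ᵥ θ0) p|) := by
  set ε := y - θ0
  set Δ := θ - θ0
  have hsplit : ε ⬝ᵥ Δ = (ε ᵥ* Q) ⬝ᵥ Δ + (ε ᵥ* G) ⬝ᵥ (D *ᵥ Δ) := by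
    rw [← dotProduct_mulVec, ← dotProduct_mulVec, mulVec_mulVec, ← dotProduct_add, ← add_mulVec,
      hQG, one_mulVec]
  have h1 : (ε ᵥ* Q) ⬝ᵥ Δ ≤ B + (1 / 4) * ∑ x, Δ x ^ 2 := by
    refine le_trans ?_ (add_le_add_left hB _)
    rw [dotProduct, Finset.mul_sum, ← Finset.sum_add_distrib]
    refine Finset.sum_le_sum fun z _ => ?_
    have : (ε ᵥ* Q) z = ∑ x, Q x z * (y x - θ0 x) :=
      Finset.sum_congr rfl fun x _ => mul_comm _ _
    rw [← this]
    nlinarith [sq_nonneg ((ε ᵥ* Q) z - Δ z / 2)]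
  have h2 : (ε ᵥ* G) ⬝ᵥ (D *ᵥ Δ) ≤
      lam * ∑ p, |(D *ᵥ θ) p| + lam * ∑ p, |(D *ᵥ θ0) p| := by
    rw [← mul_add, ← Finset.sum_add_distrib, Finset.mul_sum, dotProduct]
    refine Finset.sum_le_sum fun p _ => ?_
    have : (ε ᵥ* G) p = ∑ x, G x p * (y x - θ0 x) :=
      Finset.sum_congr rfl fun x _ => mul_comm _ _
    refine (le_abs_self _).trans ?_
    rw [abs_mul, this]
    refine mul_le_mul (hlam p) ?_ (abs_nonneg _) ((abs_nonneg _).trans (hlam p))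
    rw [show (D *ᵥ Δ) p = (D *ᵥ θ) p - (D *ᵥ θ0) p by rw [mulVec_sub]; rfl]
    exact abs_sub _ _
  have h3 : ∑ x, (y x - θ x) ^ 2 =
      ∑ x, (y x - θ0 x) ^ 2 - 2 * (ε ⬝ᵥ Δ) + ∑ x, Δ x ^ 2 := by
    rw [dotProduct, Finset.mul_sum, ← Finset.sum_sub_distrib, ← Finset.sum_add_distrib]
    refine Finset.sum_congr rfl fun x _ => ?_
    simp only [ε, Δ, Pi.sub_apply]
    ring
  change ∑ x, Δ x ^ 2 ≤ _
  linarith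

lemma card_ktfIdx_le (N d m : ℕ) : Fintype.card (KtfIdx N d m) ≤ d * N ^ d := by
  rw [Fintype.card_sigma]
  refine (Finset.sum_le_card_nsmul _ _ (N ^ d) fun j _ => ?_).trans (by simp)
  have hd : 1 ≤ d := j.pos
  have hcard : Fintype.card {l : Fin d // l ≠ j} = d - 1 := by
    rw [Fintype.card_subtype_compl]; simp
  rw [Fintype.card_prod, Fintype.card_fun, hcard, Fintype.card_fin, Fintype.card_fin]
  calc (N - m) * N ^ (d - 1) ≤ N * N ^ (d - 1) := by gcongr; omega
    _ = N ^ d := by rw [← pow_succ']; congr 1; omega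

/-- With overwhelming probability, KTF satisfies an oracle inequality at any resolution `J`. -/
lemma ktf_oracle_inequality (k d : ℕ) (hd : 1 ≤ d) {σ δ : ℝ} (hσ : 0 < σ) (hδ0 : 0 < δ)
    (hδ1 : δ < 1) :
    ∃ C : ℝ, 0 < C ∧ ∀ N : ℕ, k + 1 < N → ∀ J ≤ Nat.clog 2 N, ∀ S : ℝ, 0 < S →
      ∑ i ∈ Finset.Ico J (Nat.clog 2 N),
        (N / 2 ^ i : ℝ) ^ (2 * k + 1) * (2 ^ i / N : ℝ) ^ (d - 1) ≤ S →
      ∀ lam : ℝ, 0 ≤ lam → C * S * Real.log ((N ^ d : ℕ) : ℝ) ≤ lam ^ 2 →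
      ∀ (θ0 : (Fin d → Fin N) → ℝ) (θhat : ((Fin d → Fin N) → ℝ) → ((Fin d → Fin N) → ℝ)),
        (∀ y θ' : (Fin d → Fin N) → ℝ,
          (1 / 2) * ∑ x, (y x - θhat y x) ^ 2 +
              lam * ∑ p, |(ktfMat N d (k + 1)).mulVec (θhat y) p| ≤
            (1 / 2) * ∑ x, (y x - θ' x) ^ 2 +
              lam * ∑ p, |(ktfMat N d (k + 1)).mulVec θ' p|) →
        ENNReal.ofReal (1 - δ) ≤ gaussSeq θ0 σ {y | ∑ x, (θhat y x - θ0 x) ^ 2 ≤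
          C * (2 ^ J) ^ d + 8 * (lam * ∑ p, |(ktfMat N d (k + 1)).mulVec θ0 p|)} := by
  obtain ⟨C, hC, hdec⟩ := exists_ktf_decomposition k d
  have hd0 : (1 : ℝ) ≤ d := by exact_mod_cast hd
  have hl2 : 0 < Real.log 2 := Real.log_pos one_lt_two
  set b := 1 + Real.log (4 * d / δ) / Real.log 2 with hb
  have hratio : 1 ≤ 4 * d / δ := by rw [le_div_iff₀ hδ0]; linarith
  have hb1 : 0 ≤ b - 1 := by
    rw [hb, add_sub_cancel_left]
    exact div_nonneg (Real.log_nonneg hratio) hl2.le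
  have hb0 : 0 < b := by linarith
  refine ⟨8 * σ ^ 2 * C / δ + 2 * σ ^ 2 * C * b, by positivity,
    fun N hN J hJ S hS hsum lam hlam hlam2 θ0 θhat hmin => ?_⟩
  obtain ⟨Q, G, hQG, hQ, hG⟩ := hdec N hN J (Nat.clog 2 N) (Nat.le_pow_clog one_lt_two N)
    (fun i hi => (Nat.lt_clog_iff_pow_lt one_lt_two).1 hi |>.le) hJ
  have hn2 : (2 : ℝ) ≤ ((N ^ d : ℕ) : ℝ) := by
    exact_mod_cast (show 2 ≤ N by omega).trans (Nat.le_self_pow (by omega) N)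
  set n : ℝ := ((N ^ d : ℕ) : ℝ)
  have hlogn : Real.log 2 ≤ Real.log n := Real.log_le_log two_pos hn2
  have htail : (Fintype.card (KtfIdx N d (k + 1)) : ℝ) *
      (2 * Real.exp (-lam ^ 2 / (2 * (σ ^ 2 * (C * S))))) ≤ δ / 2 := by
    have hcard : (Fintype.card (KtfIdx N d (k + 1)) : ℝ) ≤ d * n := by
      simpa only [n, Nat.cast_mul] using
        Nat.cast_le (α := ℝ).2 (card_ktfIdx_le N d (k + 1))
    have hexp : -lam ^ 2 / (2 * (σ ^ 2 * (C * S))) ≤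
        -Real.log n + -(b - 1) * Real.log 2 := by
      have h1 : -lam ^ 2 / (2 * (σ ^ 2 * (C * S))) ≤ -(b * Real.log n) := by
        rw [div_le_iff₀ (by positivity)]
        have h2 : 0 ≤ 8 * σ ^ 2 * C / δ * S * Real.log n := by
          have := hl2.le.trans hlogn
          positivity
        nlinarith
      nlinarith
    have hval : Real.exp (-Real.log n + -(b - 1) * Real.log 2) = n⁻¹ * (δ / (4 * d)) := by
      rw [Real.exp_add, Real.exp_neg, Real.exp_log (by linarith), hb,
        show -(1 + Real.log (4 * d / δ) / Real.log 2 - 1) * Real.log 2 =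
          -Real.log (4 * d / δ) by field_simp; ring, Real.exp_neg, Real.exp_log (by positivity),
        inv_div]
    calc _ ≤ d * n * (2 * (n⁻¹ * (δ / (4 * d)))) := by
          rw [← hval]; gcongr
      _ = δ / 2 := by field_simp; ring
  refine (gaussSeq_good_event θ0 hσ hδ0 (by positivity) hlam Q G hQ
    (fun p => (hG p).trans (mul_le_mul_of_nonneg_left hsum hC.le)) htail).trans
    (measure_mono fun y hy => ?_)
  refine (sum_sq_sub_le_of_decomposition hQG (hmin y θ0) hy.1 hy.2).trans
    (add_le_add_left ?_ _)
  rw [add_mul]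
  have : 0 ≤ 2 * σ ^ 2 * C * b * ((2 : ℝ) ^ J) ^ d := by positivity
  have h2 : 4 * (2 * σ ^ 2 * (C * (2 ^ J) ^ d) / δ) = 8 * σ ^ 2 * C / δ * ((2 : ℝ) ^ J) ^ d := by
    ring
  linarith

lemma two_pow_clog_le {N : ℕ} (hN : 1 < N) : (2 : ℝ) ^ Nat.clog 2 N ≤ 2 * N := by
  have hpos : 0 < Nat.clog 2 N := Nat.clog_pos one_lt_two hN
  have h : 2 ^ (Nat.clog 2 N - 1) ≤ N :=
    ((Nat.lt_clog_iff_pow_lt one_lt_two).1 (Nat.sub_lt hpos one_pos)).le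
  have h2 : 2 ^ Nat.clog 2 N ≤ 2 * N := by
    rw [← Nat.sub_add_cancel hpos, pow_succ']
    exact Nat.mul_le_mul_left 2 h
  exact_mod_cast h2

lemma level_sum_le_of_lt {k d N : ℕ} (hkd : 2 * (k + 1) < d) (hN : 1 < N) :
    ∑ i ∈ Finset.Ico 0 (Nat.clog 2 N),
      (N / 2 ^ i : ℝ) ^ (2 * k + 1) * (2 ^ i / N : ℝ) ^ (d - 1) ≤ 2 := by
  have hN0 : (0 : ℝ) < N := by exact_mod_cast (by omega : 0 < N)
  calc _ ≤ ∑ i ∈ Finset.range (Nat.clog 2 N), (2 ^ i / N : ℝ) := by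
        rw [Finset.range_eq_Ico]
        refine Finset.sum_le_sum fun i hi => ?_
        have hi' : (2 : ℝ) ^ i ≤ N := by
          exact_mod_cast ((Nat.lt_clog_iff_pow_lt one_lt_two).1 (Finset.mem_Ico.1 hi).2).le
        rw [show d - 1 = (2 * k + 1) + (d - 1 - (2 * k + 1)) by omega,
          pow_add (2 ^ i / N : ℝ), ← mul_assoc, ← mul_pow, div_mul_div_cancel₀ (by positivity),
          div_self hN0.ne', one_pow, one_mul]
        exact pow_le_of_le_one (by positivity) ((div_le_one hN0).2 hi') (by omega)
    _ = (2 ^ Nat.clog 2 N - 1) / N := by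
        rw [← Finset.sum_div, geom_sum_eq (by norm_num)]; norm_num
    _ ≤ 2 := by
        rw [div_le_iff₀ hN0]
        linarith [two_pow_clog_le hN]

lemma level_sum_le_of_eq {k d N : ℕ} (hkd : 2 * (k + 1) = d) (hN : 1 < N) :
    ∑ i ∈ Finset.Ico 0 (Nat.clog 2 N),
      (N / 2 ^ i : ℝ) ^ (2 * k + 1) * (2 ^ i / N : ℝ) ^ (d - 1) ≤
      2 / Real.log 2 * Real.log ((N ^ d : ℕ) : ℝ) := by
  have hN0 : (0 : ℝ) < N := by exact_mod_cast (by omega : 0 < N)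
  have hN2 : (2 : ℝ) ≤ N := by exact_mod_cast hN
  have hterm : ∀ i ∈ Finset.Ico 0 (Nat.clog 2 N),
      (N / 2 ^ i : ℝ) ^ (2 * k + 1) * (2 ^ i / N : ℝ) ^ (d - 1) = 1 := fun i _ => by
    rw [show d - 1 = 2 * k + 1 by omega, ← mul_pow, div_mul_div_cancel₀ (by positivity),
      div_self hN0.ne', one_pow]
  rw [Finset.sum_congr rfl hterm, Finset.sum_const, Nat.card_Ico, nsmul_one, Nat.sub_zero,
    div_mul_eq_mul_div, le_div_iff₀ (Real.log_pos one_lt_two)]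
  have h1 := Real.log_le_log (by positivity) (two_pow_clog_le hN)
  rw [Real.log_pow, Real.log_mul two_ne_zero hN0.ne'] at h1
  have h2 := Real.log_le_log two_pos hN2
  have h3 : Real.log N ≤ Real.log ((N ^ d : ℕ) : ℝ) :=
    Real.log_le_log hN0 (by exact_mod_cast Nat.le_self_pow (by omega) N)
  linarith

/-- When `d < 2 (k + 1)`, the level sums are dominated by their coarsest level, and the
resolution `J` can be matched to any length scale `v`. -/
lemma exists_level_sum_le_of_gt {k d N : ℕ} (hd : 1 ≤ d) (hkd : d < 2 * (k + 1)) (hN : 1 < N)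
    {v : ℝ} (hv : 0 < v) :
    ∃ J ≤ Nat.clog 2 N, ((2 : ℝ) ^ J) ^ d ≤ 1 + 2 ^ d * ((N / v) ^ d) ∧
      ∑ i ∈ Finset.Ico J (Nat.clog 2 N),
        (N / 2 ^ i : ℝ) ^ (2 * k + 1) * (2 ^ i / N : ℝ) ^ (d - 1) ≤
        2 * v ^ (2 * (k + 1) - d) := by
  have hN0 : (0 : ℝ) < N := by exact_mod_cast (by omega : 0 < N)
  have hex : ∃ J : ℕ, (N : ℝ) ≤ v * 2 ^ J := by
    obtain ⟨J, hJ⟩ := pow_unbounded_of_one_lt (N / v : ℝ) one_lt_two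
    exact ⟨J, ((div_lt_iff₀' hv).1 hJ).le⟩
  classical
  obtain ⟨J, hJ, hJmin⟩ : ∃ J : ℕ, (N : ℝ) ≤ v * 2 ^ J ∧ ∀ i < J, v * 2 ^ i < (N : ℝ) :=
    ⟨Nat.find hex, Nat.find_spec hex, fun i hi => not_le.1 (Nat.find_min hex hi)⟩
  refine ⟨min J (Nat.clog 2 N), min_le_right _ _, ?_, ?_⟩
  · refine (pow_le_pow_left₀ (by positivity)
      (pow_le_pow_right₀ one_le_two (min_le_left _ _)) d).trans ?_
    rcases J with _ | j
    · have : 0 ≤ 2 ^ d * ((N / v : ℝ) ^ d) := by positivity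
      simpa using this
    · have h1 : (2 : ℝ) ^ (j + 1) ≤ 2 * (N / v) := by
        rw [pow_succ']
        gcongr
        exact (le_div_iff₀' hv).2 (hJmin j (Nat.lt_succ_self j)).le
      have h2 := pow_le_pow_left₀ (by positivity) h1 d
      rw [mul_pow] at h2
      linarith
  · rcases le_total (Nat.clog 2 N) J with h | h
    · rw [min_eq_right h, Finset.Ico_self, Finset.sum_empty]
      positivity
    · rw [min_eq_left h, Finset.sum_Ico_eq_sum_range]
      have hterm : ∀ i : ℕ, (N / 2 ^ (J + i) : ℝ) ^ (2 * k + 1) *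
          (2 ^ (J + i) / N : ℝ) ^ (d - 1) ≤ v ^ (2 * (k + 1) - d) * (1 / 2) ^ i := by
        intro i
        have h1 : (N / 2 ^ (J + i) : ℝ) ^ (2 * k + 1) * (2 ^ (J + i) / N : ℝ) ^ (d - 1) =
            (N / 2 ^ (J + i) : ℝ) ^ (2 * (k + 1) - d) := by
          rw [show 2 * k + 1 = (2 * (k + 1) - d) + (d - 1) by omega, pow_add, mul_assoc,
            ← mul_pow, div_mul_div_cancel₀ (by positivity), div_self hN0.ne', one_pow, mul_one]
        have h2 : (N / 2 ^ (J + i) : ℝ) ≤ v * (1 / 2) ^ i := by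
          rw [div_le_iff₀ (by positivity), pow_add, one_div, inv_pow]
          refine hJ.trans (le_of_eq ?_)
          field_simp
        rw [h1]
        refine (pow_le_pow_left₀ (by positivity) h2 _).trans ?_
        rw [mul_pow]
        refine mul_le_mul_of_nonneg_left ?_ (by positivity)
        exact pow_le_of_le_one (by positivity) (pow_le_one₀ (by norm_num) (by norm_num)) (by omega)
      refine (Finset.sum_le_sum fun i _ => hterm i).trans ?_
      rw [← Finset.mul_sum, mul_comm]
      refine mul_le_mul_of_nonneg_right ?_ (by positivity)
      rw [geom_sum_eq (by norm_num)]
      have : 0 < (1 / 2 : ℝ) ^ (Nat.clog 2 N - J) := by positivity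
      rw [div_le_iff_of_neg (by norm_num)]
      linarith

/-- The choice of tuning parameter balancing the two terms of the oracle inequality when
`s > 1/2`; here `ρ = n / C_n`, `l = log n`, and `v` is the corresponding length scale. -/
lemma exists_length_scale {k d : ℕ} (hd : 1 ≤ d) (hkd : d < 2 * (k + 1)) {s ρ l c : ℝ}
    (hs : s = ((k : ℝ) + 1) / d) (hρ : 0 < ρ) (hl : 0 < l) :
    ∃ v : ℝ, 0 < v ∧ (v ^ d)⁻¹ = (1 / ρ) ^ (2 / (2 * s + 1)) * l ^ (1 / (2 * s + 1)) ∧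
      (c * l ^ (1 / (2 * s + 1)) * ρ ^ ((2 * s - 1) / (2 * s + 1))) ^ 2 =
        c ^ 2 * l * v ^ (2 * (k + 1) - d) ∧
      c * l ^ (1 / (2 * s + 1)) * ρ ^ ((2 * s - 1) / (2 * s + 1)) * (1 / ρ) =
        c * (v ^ d)⁻¹ := by
  have hd0 : (0 : ℝ) < d := by exact_mod_cast hd
  have hs0 : 0 < s := by rw [hs]; positivity
  have hq : 0 < 2 * s + 1 := by positivity
  set v := Real.exp ((2 * Real.log ρ - Real.log l) / ((2 * s + 1) * d))
  have hvd : v ^ d = Real.exp ((2 * Real.log ρ - Real.log l) / (2 * s + 1)) := by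
    rw [← Real.exp_nat_mul]; congr 1; field_simp
  have hve : v ^ (2 * (k + 1) - d) =
      Real.exp ((2 * s - 1) * ((2 * Real.log ρ - Real.log l) / (2 * s + 1))) := by
    rw [← Real.exp_nat_mul]
    congr 1
    rw [Nat.cast_sub hkd.le, hs]
    push_cast
    field_simp
  have hlq : l ^ (1 / (2 * s + 1)) = Real.exp (Real.log l / (2 * s + 1)) := by
    rw [Real.rpow_def_of_pos hl]; congr 1; ring
  have hinv : (v ^ d)⁻¹ = Real.exp (-((2 * Real.log ρ - Real.log l) / (2 * s + 1))) := by
    rw [hvd, Real.exp_neg]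
  have hρq : ρ ^ ((2 * s - 1) / (2 * s + 1)) =
      Real.exp (Real.log ρ * ((2 * s - 1) / (2 * s + 1))) := Real.rpow_def_of_pos hρ _
  have hρinv : 1 / ρ = Real.exp (-Real.log ρ) := by rw [Real.exp_neg, Real.exp_log hρ, one_div]
  refine ⟨v, Real.exp_pos _, ?_, ?_, ?_⟩
  · rw [hinv, hlq, hρinv, ← Real.exp_mul, ← Real.exp_add]
    congr 1; field_simp; ring
  · rw [hve, mul_pow, mul_pow, hlq, hρq, ← Real.exp_nat_mul, ← Real.exp_nat_mul]
    rw [mul_assoc, mul_assoc, show l * Real.exp _ = Real.exp (Real.log l) * _ by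
      rw [Real.exp_log hl], ← Real.exp_add, ← Real.exp_add]
    congr 2; push_cast; field_simp; ring
  · rw [hinv, hlq, hρq, hρinv, mul_assoc, mul_assoc, ← Real.exp_add, ← Real.exp_add]
    congr 2; field_simp; ring

/-- Under the canonical scaling, `(v ^ d)⁻¹` is of the order of the rate. -/
lemma rpow_mul_rpow_le_of_canonical {s n l a Cn : ℝ} (hs : 0 < s) (hn : 0 < n) (hl : 0 < l)
    (ha : 0 < a) (hC0 : 0 < Cn) (hC : Cn ≤ a * n ^ (1 - s)) :
    (1 / (n / Cn)) ^ (2 / (2 * s + 1)) * l ^ (1 / (2 * s + 1)) ≤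
      a ^ (2 / (2 * s + 1)) * (n ^ (-(2 * s) / (2 * s + 1)) * l ^ (1 / (2 * s + 1))) := by
  rw [← mul_assoc]
  gcongr
  have h1 : 1 / (n / Cn) ≤ a * n ^ (-s) := by
    rw [one_div_div, div_le_iff₀ hn, mul_assoc]
    refine hC.trans (le_of_eq ?_)
    nth_rw 3 [← Real.rpow_one n]
    rw [← Real.rpow_add hn]
    ring_nf
  refine (Real.rpow_le_rpow (by positivity) h1 (by positivity)).trans (le_of_eq ?_)
  rw [Real.mul_rpow ha.le (by positivity), ← Real.rpow_mul hn.le]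
  ring_nf

lemma one_div_le_rpow_neg {n t : ℝ} (hn : 1 ≤ n) (ht : t ≤ 1) : 1 / n ≤ n ^ (-t) := by
  rw [one_div, ← Real.rpow_neg_one]
  exact Real.rpow_le_rpow_of_exponent_le hn (by linarith)

/-- Conversion of the oracle inequality into the rate when `s ≤ 1/2`. -/
lemma risk_le_of_canonical {s n g g0 a Cn C c X : ℝ} (hn : 1 ≤ n) (hs : s ≤ 1) (hg0 : 0 < g0)
    (hg : g0 ≤ g) (hC : 0 ≤ C) (hc : 0 ≤ c) (hCn : Cn ≤ a * n ^ (1 - s))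
    (hX : X ≤ C + 8 * (c * g * Cn)) :
    1 / n * X ≤ (C / g0 + 8 * c * a) * (n ^ (-s) * g) := by
  have hn0 : 0 < n := by linarith
  have hgp : 0 < g := hg0.trans_le hg
  have hsplit : n ^ (1 - s) = n * n ^ (-s) := by
    rw [sub_eq_add_neg, Real.rpow_add hn0, Real.rpow_one]
  have h1 : 1 / n * C ≤ C / g0 * (n ^ (-s) * g) := by
    have h := one_div_le_rpow_neg hn hs
    calc 1 / n * C ≤ n ^ (-s) * C := by gcongr
      _ = C / g0 * (n ^ (-s) * g0) := by field_simp
      _ ≤ _ := by gcongr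
  have h2 : 1 / n * (8 * (c * g * Cn)) ≤ 8 * c * a * (n ^ (-s) * g) := by
    calc 1 / n * (8 * (c * g * Cn)) ≤ 1 / n * (8 * (c * g * (a * n ^ (1 - s)))) := by gcongr
      _ = _ := by rw [hsplit]; field_simp
  calc 1 / n * X ≤ 1 / n * (C + 8 * (c * g * Cn)) := by gcongr
    _ ≤ _ := by rw [mul_add, add_mul]; exact add_le_add h1 h2

/-- Corollary 1: KTF error rates under the canonical scaling.
With `s = (k+1)/d` and `0 < C_n = ‖D_{n,d}^{(k+1)} θ₀‖₁ ≤ a n^{1-s}`, there are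
constants `c₁, c₂ > 0` (depending only on `k, d, σ, a, δ`) and a choice of tuning
parameter `λ` (as in Theorem 3) such that the KTF estimator satisfies, with
probability at least `1-δ`: `(1/n)‖θ̂-θ₀‖₂² ≤ c₂ n^{-s}√(log n)` if `s < 1/2`,
`≤ c₂ n^{-s} log n` if `s = 1/2`, and `≤ c₂ n^{-2s/(2s+1)} (log n)^{1/(2s+1)}` if
`s > 1/2`. -/
theorem ktf_error_bound_canonical (k d : ℕ) (hd : 1 ≤ d) (σ : ℝ) (hσ : 0 < σ)
    (a : ℝ) (ha : 0 < a) (δ : ℝ) (hδ0 : 0 < δ) (hδ1 : δ < 1) :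
    ∃ c₁ : ℝ, 0 < c₁ ∧ ∃ c₂ : ℝ, 0 < c₂ ∧
      ∀ N : ℕ, k + 1 < N →
      ∀ θ0 : (Fin d → Fin N) → ℝ,
        0 < ∑ p, |(ktfMat N d (k + 1)).mulVec θ0 p| →
        ∑ p, |(ktfMat N d (k + 1)).mulVec θ0 p| ≤
          a * ((N ^ d : ℕ) : ℝ) ^ (1 - ((k : ℝ) + 1) / d) →
      ∀ lam : ℝ,
        lam = (if 2 * (k + 1) < d then c₁ * Real.sqrt (Real.log ((N ^ d : ℕ) : ℝ))
          else if 2 * (k + 1) = d then c₁ * Real.log ((N ^ d : ℕ) : ℝ)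
          else c₁ * Real.log ((N ^ d : ℕ) : ℝ) ^
                ((1 : ℝ) / (2 * (((k : ℝ) + 1) / d) + 1)) *
              (((N ^ d : ℕ) : ℝ) / ∑ p, |(ktfMat N d (k + 1)).mulVec θ0 p|) ^
                ((2 * (((k : ℝ) + 1) / d) - 1) / (2 * (((k : ℝ) + 1) / d) + 1))) →
      ∀ θhat : ((Fin d → Fin N) → ℝ) → ((Fin d → Fin N) → ℝ),
        (∀ y θ' : (Fin d → Fin N) → ℝ,
          (1 / 2) * ∑ x, (y x - θhat y x) ^ 2 +
              lam * ∑ p, |(ktfMat N d (k + 1)).mulVec (θhat y) p| ≤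
            (1 / 2) * ∑ x, (y x - θ' x) ^ 2 +
              lam * ∑ p, |(ktfMat N d (k + 1)).mulVec θ' p|) →
        gaussSeq θ0 σ
            {y | (1 / ((N ^ d : ℕ) : ℝ)) * ∑ x, (θhat y x - θ0 x) ^ 2 ≤
              c₂ * (if 2 * (k + 1) < d then
                  ((N ^ d : ℕ) : ℝ) ^ (-(((k : ℝ) + 1) / d)) *
                    Real.sqrt (Real.log ((N ^ d : ℕ) : ℝ))
                else if 2 * (k + 1) = d then
                  ((N ^ d : ℕ) : ℝ) ^ (-(((k : ℝ) + 1) / d)) * Real.log ((N ^ d : ℕ) : ℝ)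
                else
                  ((N ^ d : ℕ) : ℝ) ^
                      (-(2 * (((k : ℝ) + 1) / d)) / (2 * (((k : ℝ) + 1) / d) + 1)) *
                    Real.log ((N ^ d : ℕ) : ℝ) ^
                      ((1 : ℝ) / (2 * (((k : ℝ) + 1) / d) + 1)))} ≥
          ENNReal.ofReal (1 - δ) := by
  obtain ⟨C, hC, horacle⟩ := ktf_oracle_inequality k d hd hσ hδ0 hδ1
  have hd0 : (0 : ℝ) < d := by exact_mod_cast hd
  have hl2 : 0 < Real.log 2 := Real.log_pos one_lt_two
  set s : ℝ := ((k : ℝ) + 1) / d with hs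
  have hs0 : 0 < s := by positivity
  have hbase : ∀ N : ℕ, k + 1 < N → (1 : ℝ) ≤ ((N ^ d : ℕ) : ℝ) ∧
      Real.log 2 ≤ Real.log ((N ^ d : ℕ) : ℝ) := by
    intro N hN
    have hn2 : (2 : ℝ) ≤ ((N ^ d : ℕ) : ℝ) := by
      exact_mod_cast (show 2 ≤ N by omega).trans (Nat.le_self_pow (by omega) N)
    exact ⟨by linarith, Real.log_le_log two_pos hn2⟩
  rcases lt_trichotomy (2 * (k + 1)) d with hkd | hkd | hkd
  · have hs1 : s ≤ 1 := by
      rw [hs, div_le_one hd0]; exact_mod_cast (by omega : k + 1 ≤ d)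
    refine ⟨√(2 * C), by positivity, C / √(Real.log 2) + 8 * √(2 * C) * a, by positivity,
      fun N hN θ0 hpos hle lam hlam θhat hmin => ?_⟩
    obtain ⟨hn1, hlog⟩ := hbase N hN
    rw [if_pos hkd] at hlam ⊢
    have h := horacle N hN 0 (Nat.zero_le _) 2 two_pos (level_sum_le_of_lt hkd (by omega)) lam
      (by rw [hlam]; positivity)
      (by rw [hlam, mul_pow, Real.sq_sqrt (by positivity), Real.sq_sqrt (hl2.le.trans hlog),
            mul_comm C]) θ0 θhat hmin
    refine h.trans (measure_mono fun y hy => ?_)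
    rw [Set.mem_ofPred_eq, pow_zero, one_pow, mul_one, hlam] at hy
    exact risk_le_of_canonical hn1 hs1 (Real.sqrt_pos.2 hl2) (Real.sqrt_le_sqrt hlog) hC.le
      (Real.sqrt_nonneg _) hle hy
  · have hs1 : s ≤ 1 := by
      rw [hs, div_le_one hd0]; exact_mod_cast (by omega : k + 1 ≤ d)
    refine ⟨√(C * (2 / Real.log 2)), by positivity,
      C / Real.log 2 + 8 * √(C * (2 / Real.log 2)) * a, by positivity,
      fun N hN θ0 hpos hle lam hlam θhat hmin => ?_⟩
    obtain ⟨hn1, hlog⟩ := hbase N hN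
    have hlogn := hl2.trans_le hlog
    rw [if_neg hkd.not_lt, if_pos hkd] at hlam ⊢
    have h := horacle N hN 0 (Nat.zero_le _) _ (by positivity)
      (level_sum_le_of_eq hkd (by omega)) lam (by rw [hlam]; positivity)
      (by rw [hlam, mul_pow, Real.sq_sqrt (by positivity)]; exact le_of_eq (by ring))
      θ0 θhat hmin
    refine h.trans (measure_mono fun y hy => ?_)
    rw [Set.mem_ofPred_eq, pow_zero, one_pow, mul_one, hlam] at hy
    exact risk_le_of_canonical hn1 hs1 hl2 hlog hC.le (Real.sqrt_nonneg _) hle hy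
  · refine ⟨√(2 * C), by positivity,
      C / Real.log 2 ^ ((1 : ℝ) / (2 * s + 1)) +
        (C * 2 ^ d + 8 * √(2 * C)) * a ^ (2 / (2 * s + 1)), by positivity,
      fun N hN θ0 hpos hle lam hlam θhat hmin => ?_⟩
    obtain ⟨hn1, hlog⟩ := hbase N hN
    have hlogn := hl2.trans_le hlog
    rw [if_neg hkd.not_gt, if_neg hkd.ne'] at hlam ⊢
    set Cn := ∑ p, |(ktfMat N d (k + 1) *ᵥ θ0) p|
    set n : ℝ := ((N ^ d : ℕ) : ℝ) with hn
    have hn0 : 0 < n := by linarith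
    obtain ⟨v, hv, hvd, hsq, hmul⟩ := exists_length_scale (c := √(2 * C)) hd hkd hs
      (div_pos hn0 hpos) hlogn
    obtain ⟨J, hJ, hJd, hsum⟩ := exists_level_sum_le_of_gt hd hkd (by omega : 1 < N) hv
    have h := horacle N hN J hJ _ (by positivity) hsum lam (by rw [hlam]; positivity)
      (by rw [hlam, hsq, Real.sq_sqrt (by positivity)]; exact le_of_eq (by ring)) θ0 θhat hmin
    refine h.trans (measure_mono fun y hy => ?_)
    rw [← hlam, one_div_div] at hmul
    have hlamC : 1 / n * (8 * (lam * Cn)) = 8 * √(2 * C) * (v ^ d)⁻¹ := by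
      rw [mul_assoc 8, ← hmul]; ring
    have hJn : 1 / n * (C * (2 ^ J) ^ d) ≤ C * (1 / n) + C * 2 ^ d * (v ^ d)⁻¹ := by
      refine (mul_le_mul_of_nonneg_left (mul_le_mul_of_nonneg_left hJd hC.le)
        (by positivity)).trans (le_of_eq ?_)
      rw [div_pow, show ((N : ℝ) ^ d) = n by rw [hn, Nat.cast_pow]]
      field_simp
    have hrate := rpow_mul_rpow_le_of_canonical hs0 hn0 hlogn ha hpos hle
    rw [← hvd] at hrate
    set R := n ^ (-(2 * s) / (2 * s + 1)) * Real.log n ^ ((1 : ℝ) / (2 * s + 1)) with hR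
    have h1 : C * (1 / n) ≤ C / Real.log 2 ^ ((1 : ℝ) / (2 * s + 1)) * R := by
      have hexp : 2 * s / (2 * s + 1) ≤ 1 := by
        rw [div_le_one (by positivity)]; linarith
      have hpow := one_div_le_rpow_neg hn1 hexp
      rw [← neg_div] at hpow
      calc C * (1 / n) ≤ C * n ^ (-(2 * s) / (2 * s + 1)) := by gcongr
        _ = C / Real.log 2 ^ ((1 : ℝ) / (2 * s + 1)) *
            (n ^ (-(2 * s) / (2 * s + 1)) * Real.log 2 ^ ((1 : ℝ) / (2 * s + 1))) := by
          field_simp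
        _ ≤ _ := by rw [hR]; gcongr
    rw [Set.mem_ofPred_eq] at hy ⊢
    have h2 : (C * 2 ^ d + 8 * √(2 * C)) * (v ^ d)⁻¹ ≤
        (C * 2 ^ d + 8 * √(2 * C)) * (a ^ (2 / (2 * s + 1)) * R) := by gcongr
    have h3 := mul_le_mul_of_nonneg_left hy (by positivity : 0 ≤ 1 / n)
    rw [mul_add, hlamC] at h3
    linarith
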